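/- Suppose the matrix A together with γ̄ satisfies Assumption 2, and for each X₀ ∈ S(n,d,γ̄) let v(X₀) ∈ S^{n-1} be the (unique) strictly positive unit vector to which all Euclidean-normalized rows of Ã(k,t₀,X₀) converge as k → ∞. Then the map X₀ ↦ v(X₀) is continuous on S(n,d,γ̄). -/

import Mathlib

open Finset Filter Topology Matrix

noncomputable def euclNorm {d : ℕ} (x : Fin d → ℝ) : ℝ := Real.sqrt (∑ j, x j ^ 2)

def unitSphere (d : ℕ) : Set (Fin d → ℝ) := {x | euclNorm x = 1}

/-- A directional function on `S^{d-1}`: continuous and bounded above and below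
by positive constants on the unit sphere. -/
def IsDirectional {d : ℕ} (γ : (Fin d → ℝ) → ℝ) : Prop :=
  ContinuousOn γ (unitSphere d) ∧
    ∃ c C : ℝ, 0 < c ∧ ∀ x ∈ unitSphere d, c ≤ γ x ∧ γ x ≤ C

/-- The star boundary `S^{d-1}_γ = {γ(x) x : x ∈ S^{d-1}}`. -/
def starBoundary {d : ℕ} (γ : (Fin d → ℝ) → ℝ) : Set (Fin d → ℝ) :=
  {y | ∃ x ∈ unitSphere d, y = γ x • x}

/-- `S(n,d,γ̄)`: matrices whose `i`-th row lies on the star boundary of `γ_i`. -/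
def Sset (n d : ℕ) (γbar : Fin n → (Fin d → ℝ) → ℝ) : Set (Matrix (Fin n) (Fin d) ℝ) :=
  {X | ∀ i, X i ∈ starBoundary (γbar i)}

/-- Radial projection `P_γ(y) = γ(y/‖y‖₂) · y/‖y‖₂`. -/
noncomputable def radialProj {d : ℕ} (γ : (Fin d → ℝ) → ℝ) (y : Fin d → ℝ) : Fin d → ℝ :=
  γ ((euclNorm y)⁻¹ • y) • ((euclNorm y)⁻¹ • y)

/-- Row-wise radial projection. -/
noncomputable def rowProj {n d : ℕ} (γbar : Fin n → (Fin d → ℝ) → ℝ)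
    (B : Matrix (Fin n) (Fin d) ℝ) : Matrix (Fin n) (Fin d) ℝ :=
  Matrix.of fun i => radialProj (γbar i) (B i)

/-- Assumption 2: each `γ_i` is directional, `A` is a nonnegative weight matrix of a strongly
connected digraph, and the diagonal-dominance condition
`a_ii · min γ_i > Σ_{j≠i} a_ij · max γ_j` holds. -/
def Assumption2 {n d : ℕ} (A : Matrix (Fin n) (Fin n) ℝ)
    (γbar : Fin n → (Fin d → ℝ) → ℝ) : Prop :=
  (∀ i, IsDirectional (γbar i)) ∧
  (∃ E : Fin n → Fin n → Prop,
    (∀ i j, E i j → 0 < A i j) ∧ (∀ i j, ¬ E i j → A i j = 0) ∧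
    (∀ i j, Relation.ReflTransGen E i j)) ∧
  (∀ i, (∑ j ∈ Finset.univ.erase i, A i j * sSup (γbar j '' unitSphere d)) <
      A i i * sInf (γbar i '' unitSphere d))

/-- The trajectory of the algorithm `X(t+1) = P_γ̄(A X(t))`, indexed by `k = t - t₀`. -/
noncomputable def traj {n d : ℕ} (A : Matrix (Fin n) (Fin n) ℝ)
    (γbar : Fin n → (Fin d → ℝ) → ℝ) (X₀ : Matrix (Fin n) (Fin d) ℝ) :
    ℕ → Matrix (Fin n) (Fin d) ℝ
  | 0 => X₀
  | k + 1 => rowProj γbar (A * traj A γbar X₀ k)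

/-- `D_γ̄(B)`: diagonal matrix with entries `γ_i([B]_i/‖[B]_i‖₂)/‖[B]_i‖₂`. -/
noncomputable def Dmat {n d : ℕ} (γbar : Fin n → (Fin d → ℝ) → ℝ)
    (B : Matrix (Fin n) (Fin d) ℝ) : Matrix (Fin n) (Fin n) ℝ :=
  Matrix.diagonal fun i => γbar i ((euclNorm (B i))⁻¹ • B i) / euclNorm (B i)

/-- The product matrices `Ã(k,t₀,X₀) = D_γ̄(A X(t₀+k−1))A ⋯ D_γ̄(A X(t₀))A`. -/
noncomputable def Atilde {n d : ℕ} (A : Matrix (Fin n) (Fin n) ℝ)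
    (γbar : Fin n → (Fin d → ℝ) → ℝ) (X₀ : Matrix (Fin n) (Fin d) ℝ) :
    ℕ → Matrix (Fin n) (Fin n) ℝ
  | 0 => 1
  | k + 1 => Dmat γbar (A * traj A γbar X₀ k) * A * Atilde A γbar X₀ k

/-- `v` is the strictly positive unit vector to which all Euclidean-normalized rows of
`Ã(k,t₀,X₀)` converge. -/
def IsLimitVec {n d : ℕ} (A : Matrix (Fin n) (Fin n) ℝ)
    (γbar : Fin n → (Fin d → ℝ) → ℝ) (X₀ : Matrix (Fin n) (Fin d) ℝ)
    (v : Fin n → ℝ) : Prop :=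
  euclNorm v = 1 ∧ (∀ i, 0 < v i) ∧
    ∀ i, Tendsto (fun k => (euclNorm (Atilde A γbar X₀ k i))⁻¹ • Atilde A γbar X₀ k i)
      atTop (𝓝 v)

/-- Asymptotic consensus of directions. -/
def ConsensusDir {n d : ℕ} (X : ℕ → Matrix (Fin n) (Fin d) ℝ) : Prop :=
  ∀ i j, Tendsto
    (fun t => euclNorm ((euclNorm (X t i))⁻¹ • X t i - (euclNorm (X t j))⁻¹ • X t j))
    atTop (𝓝 0)

/-- Asymptotic consensus of directions with point-wise convergence to a unit vector. -/
def ConsensusPW {n d : ℕ} (X : ℕ → Matrix (Fin n) (Fin d) ℝ) : Prop :=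
  ∃ u : Fin d → ℝ, euclNorm u = 1 ∧
    ∀ i, Tendsto (fun t => (euclNorm (X t i))⁻¹ • X t i) atTop (𝓝 u)

lemma euclNorm_eq_norm {d : ℕ} (x : Fin d → ℝ) : euclNorm x = ‖WithLp.toLp 2 x‖ := by
  simp [euclNorm, EuclideanSpace.norm_eq]

lemma euclNorm_nonneg {d : ℕ} (x : Fin d → ℝ) : 0 ≤ euclNorm x := Real.sqrt_nonneg _

lemma euclNorm_smul {d : ℕ} (c : ℝ) (x : Fin d → ℝ) : euclNorm (c • x) = |c| * euclNorm x := by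
  simp [euclNorm_eq_norm, norm_smul]

lemma euclNorm_ne_zero {d : ℕ} {x : Fin d → ℝ} (hx : x ≠ 0) : euclNorm x ≠ 0 := by
  simpa [euclNorm_eq_norm] using hx

lemma euclNorm_sum_le {ι : Type*} {d : ℕ} (s : Finset ι) (f : ι → Fin d → ℝ) :
    euclNorm (∑ j ∈ s, f j) ≤ ∑ j ∈ s, euclNorm (f j) := by
  simp only [euclNorm_eq_norm, WithLp.toLp_sum]
  exact norm_sum_le _ _

lemma continuous_euclNorm {d : ℕ} : Continuous (euclNorm : (Fin d → ℝ) → ℝ) := by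
  unfold euclNorm
  fun_prop

lemma sum_sq_eq_one {d : ℕ} {x : Fin d → ℝ} (hx : euclNorm x = 1) : ∑ j, x j ^ 2 = 1 := by
  simpa [euclNorm] using hx

lemma normalize_mem_unitSphere {d : ℕ} {y : Fin d → ℝ} (hy : y ≠ 0) :
    (euclNorm y)⁻¹ • y ∈ unitSphere d := by
  have h := euclNorm_ne_zero hy
  simp [unitSphere, euclNorm_smul, abs_of_nonneg (euclNorm_nonneg y), h]

lemma continuousOn_normalize {d : ℕ} :
    ContinuousOn (fun y : Fin d → ℝ => (euclNorm y)⁻¹ • y) {y | y ≠ 0} :=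
  (continuous_euclNorm.continuousOn.inv₀ fun _ hy => euclNorm_ne_zero hy).smul continuousOn_id

lemma IsDirectional.pos {d : ℕ} {γ : (Fin d → ℝ) → ℝ} (hγ : IsDirectional γ) {x : Fin d → ℝ}
    (hx : x ∈ unitSphere d) : 0 < γ x := by
  obtain ⟨-, c, C, hc, h⟩ := hγ
  exact hc.trans_le (h x hx).1

lemma IsDirectional.continuousOn_normalize {d : ℕ} {γ : (Fin d → ℝ) → ℝ} (hγ : IsDirectional γ) :
    ContinuousOn (fun y => γ ((euclNorm y)⁻¹ • y)) {y | y ≠ 0} :=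
  hγ.1.comp _root_.continuousOn_normalize fun _ hy => normalize_mem_unitSphere hy

lemma IsDirectional.euclNorm_mem_Icc {d : ℕ} {γ : (Fin d → ℝ) → ℝ} (hγ : IsDirectional γ)
    {y : Fin d → ℝ} (hy : y ∈ starBoundary γ) :
    euclNorm y ∈ Set.Icc (sInf (γ '' unitSphere d)) (sSup (γ '' unitSphere d)) := by
  obtain ⟨x, hx, rfl⟩ := hy
  have hpos := hγ.pos hx
  obtain ⟨-, c, C, hc, h⟩ := hγ
  have hx1 : euclNorm x = 1 := hx
  rw [euclNorm_smul, hx1, mul_one, abs_of_pos hpos]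
  refine ⟨csInf_le ⟨c, ?_⟩ ⟨x, hx, rfl⟩, le_csSup ⟨C, ?_⟩ ⟨x, hx, rfl⟩⟩
  · rintro _ ⟨z, hz, rfl⟩
    exact (h z hz).1
  · rintro _ ⟨z, hz, rfl⟩
    exact (h z hz).2

lemma Assumption2.nonneg {n d : ℕ} {A : Matrix (Fin n) (Fin n) ℝ}
    {γbar : Fin n → (Fin d → ℝ) → ℝ} (hA : Assumption2 A γbar) (i j : Fin n) : 0 ≤ A i j := by
  obtain ⟨-, ⟨E, hE, hE', -⟩, -⟩ := hA
  by_cases h : E i j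
  · exact (hE i j h).le
  · exact (hE' i j h).ge

lemma Matrix.mul_row_eq_sum {n m p : ℕ} (A : Matrix (Fin n) (Fin m) ℝ)
    (X : Matrix (Fin m) (Fin p) ℝ) (i : Fin n) : (A * X) i = ∑ j, A i j • X j := by
  ext k
  simp [Matrix.mul_apply]

lemma continuousOn_mul_row {α : Type*} [TopologicalSpace α] {n m p : ℕ}
    (A : Matrix (Fin n) (Fin m) ℝ) {f : α → Matrix (Fin m) (Fin p) ℝ} {s : Set α}
    (hf : ContinuousOn f s) (i : Fin n) : ContinuousOn (fun x => (A * f x) i) s :=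
  ((continuous_apply i).comp (continuous_const.matrix_mul continuous_id)).comp_continuousOn hf

/-- Diagonal dominance keeps the rows of `A X` away from the origin. -/
lemma Assumption2.mul_row_ne_zero {n d : ℕ} {A : Matrix (Fin n) (Fin n) ℝ}
    {γbar : Fin n → (Fin d → ℝ) → ℝ} (hA : Assumption2 A γbar)
    {X : Matrix (Fin n) (Fin d) ℝ} (hX : X ∈ Sset n d γbar) (i : Fin n) : (A * X) i ≠ 0 := by
  intro h0
  rw [Matrix.mul_row_eq_sum, ← Finset.add_sum_erase _ _ (Finset.mem_univ i)] at h0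
  have h1 : A i i * euclNorm (X i) = euclNorm (∑ j ∈ univ.erase i, A i j • X j) := by
    rw [← abs_of_nonneg (hA.nonneg i i), ← euclNorm_smul, eq_neg_of_add_eq_zero_left h0,
      ← neg_one_smul ℝ, euclNorm_smul]
    simp
  have h2 : euclNorm (∑ j ∈ univ.erase i, A i j • X j) ≤
      ∑ j ∈ univ.erase i, A i j * sSup (γbar j '' unitSphere d) := by
    refine (euclNorm_sum_le _ _).trans (Finset.sum_le_sum fun j _ => ?_)
    rw [euclNorm_smul, abs_of_nonneg (hA.nonneg i j)]
    exact mul_le_mul_of_nonneg_left ((hA.1 j).euclNorm_mem_Icc (hX j)).2 (hA.nonneg i j)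
  have h3 := mul_le_mul_of_nonneg_left ((hA.1 i).euclNorm_mem_Icc (hX i)).1 (hA.nonneg i i)
  have h4 := hA.2.2 i
  linarith

lemma Assumption2.traj_mem {n d : ℕ} {A : Matrix (Fin n) (Fin n) ℝ}
    {γbar : Fin n → (Fin d → ℝ) → ℝ} (hA : Assumption2 A γbar)
    {X : Matrix (Fin n) (Fin d) ℝ} (hX : X ∈ Sset n d γbar) (k : ℕ) :
    traj A γbar X k ∈ Sset n d γbar := by
  induction k with
  | zero => exact hX
  | succ k ih =>
    exact fun i => ⟨_, normalize_mem_unitSphere (hA.mul_row_ne_zero ih i), rfl⟩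

lemma Assumption2.continuousOn_traj {n d : ℕ} {A : Matrix (Fin n) (Fin n) ℝ}
    {γbar : Fin n → (Fin d → ℝ) → ℝ} (hA : Assumption2 A γbar) (k : ℕ) :
    ContinuousOn (fun X => traj A γbar X k) (Sset n d γbar) := by
  induction k with
  | zero => exact continuousOn_id
  | succ k ih =>
    refine continuousOn_pi.2 fun i => ?_
    have hrow : ContinuousOn (fun X => (A * traj A γbar X k) i) (Sset n d γbar) :=
      continuousOn_mul_row A ih i
    have hne : Set.MapsTo (fun X => (A * traj A γbar X k) i) (Sset n d γbar) {y | y ≠ 0} :=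
      fun X hX => hA.mul_row_ne_zero (hA.traj_mem hX k) i
    exact ((hA.1 i).continuousOn_normalize.comp hrow hne).smul
      (continuousOn_normalize.comp hrow hne)

lemma Assumption2.continuousOn_Atilde {n d : ℕ} {A : Matrix (Fin n) (Fin n) ℝ}
    {γbar : Fin n → (Fin d → ℝ) → ℝ} (hA : Assumption2 A γbar) (k : ℕ) :
    ContinuousOn (fun X => Atilde A γbar X k) (Sset n d γbar) := by
  induction k with
  | zero => exact continuousOn_const
  | succ k ih =>
    have hD : ContinuousOn (fun X => Dmat γbar (A * traj A γbar X k)) (Sset n d γbar) := by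
      have hdiag : ContinuousOn (fun X i => γbar i ((euclNorm ((A * traj A γbar X k) i))⁻¹ •
          (A * traj A γbar X k) i) / euclNorm ((A * traj A γbar X k) i)) (Sset n d γbar) := by
        refine continuousOn_pi.2 fun i => ?_
        have hrow : ContinuousOn (fun X => (A * traj A γbar X k) i) (Sset n d γbar) :=
          continuousOn_mul_row A (hA.continuousOn_traj k) i
        have hne : Set.MapsTo (fun X => (A * traj A γbar X k) i) (Sset n d γbar) {y | y ≠ 0} :=
          fun X hX => hA.mul_row_ne_zero (hA.traj_mem hX k) i
        exact ((hA.1 i).continuousOn_normalize.comp hrow hne).div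
          (continuous_euclNorm.comp_continuousOn hrow) fun X hX => euclNorm_ne_zero (hne hX)
      exact (Continuous.matrix_diagonal continuous_id).comp_continuousOn hdiag
    exact (hD.mul continuousOn_const).mul ih

/-- A linear functional nonnegative on the rows of one product matrix stays nonnegative on the
rows of all later ones: the cones spanned by the rows are nested. -/
lemma Assumption2.Atilde_row_nonneg {n d : ℕ} {A : Matrix (Fin n) (Fin n) ℝ}
    {γbar : Fin n → (Fin d → ℝ) → ℝ} (hA : Assumption2 A γbar)
    {X : Matrix (Fin n) (Fin d) ℝ} (hX : X ∈ Sset n d γbar) (L : (Fin n → ℝ) →ₗ[ℝ] ℝ)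
    {k m : ℕ} (hkm : k ≤ m) (h : ∀ i, 0 ≤ L (Atilde A γbar X k i)) (i : Fin n) :
    0 ≤ L (Atilde A γbar X m i) := by
  induction m, hkm using Nat.le_induction generalizing i with
  | base => exact h i
  | succ m _ ih =>
    rw [Atilde, Matrix.mul_row_eq_sum, map_sum]
    refine Finset.sum_nonneg fun j _ => ?_
    rw [map_smul, smul_eq_mul, Dmat, Matrix.diagonal_mul]
    have hne := hA.mul_row_ne_zero (hA.traj_mem hX m) i
    exact mul_nonneg (mul_nonneg (div_nonneg ((hA.1 i).pos (normalize_mem_unitSphere hne)).le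
      (euclNorm_nonneg _)) (hA.nonneg i j)) (ih j)

lemma IsLimitVec.nonneg_of_nonneg {n d : ℕ} {A : Matrix (Fin n) (Fin n) ℝ}
    {γbar : Fin n → (Fin d → ℝ) → ℝ} (hA : Assumption2 A γbar)
    {X : Matrix (Fin n) (Fin d) ℝ} (hX : X ∈ Sset n d γbar) {v : Fin n → ℝ}
    (hv : IsLimitVec A γbar X v) (i : Fin n) (L : (Fin n → ℝ) →ₗ[ℝ] ℝ) {k : ℕ}
    (h : ∀ i, 0 ≤ L (Atilde A γbar X k i)) : 0 ≤ L v := by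
  refine ge_of_tendsto ((L.continuous_of_finiteDimensional.tendsto v).comp (hv.2.2 i)) ?_
  filter_upwards [eventually_ge_atTop k] with m hm
  rw [Function.comp_apply, map_smul]
  exact smul_nonneg (inv_nonneg.2 (euclNorm_nonneg _)) (hA.Atilde_row_nonneg hX L hm h i)

lemma IsLimitVec.eventually_pos {n d : ℕ} {A : Matrix (Fin n) (Fin n) ℝ}
    {γbar : Fin n → (Fin d → ℝ) → ℝ} {X : Matrix (Fin n) (Fin d) ℝ} {v : Fin n → ℝ}
    (hv : IsLimitVec A γbar X v) {L : (Fin n → ℝ) →ₗ[ℝ] ℝ} (hL : 0 < L v) :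
    ∀ᶠ k in atTop, ∀ i, 0 < L (Atilde A γbar X k i) := by
  refine eventually_all.2 fun i => ?_
  have h := (L.continuous_of_finiteDimensional.tendsto v).comp (hv.2.2 i)
  filter_upwards [h.eventually_const_lt hL] with k hk
  rw [Function.comp_apply, map_smul] at hk
  exact pos_of_mul_pos_right hk (inv_nonneg.2 (euclNorm_nonneg _))

/-- Functionals positive at the limit vector stay nonnegative at nearby limit vectors. -/
lemma IsLimitVec.eventually_nonneg {n d : ℕ} (hn : 1 ≤ n) {A : Matrix (Fin n) (Fin n) ℝ}
    {γbar : Fin n → (Fin d → ℝ) → ℝ} (hA : Assumption2 A γbar)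
    {v : Matrix (Fin n) (Fin d) ℝ → Fin n → ℝ}
    (hv : ∀ X ∈ Sset n d γbar, IsLimitVec A γbar X (v X))
    {X₀ : Matrix (Fin n) (Fin d) ℝ} (hX₀ : X₀ ∈ Sset n d γbar) {L : (Fin n → ℝ) →ₗ[ℝ] ℝ}
    (hL : 0 < L (v X₀)) : ∀ᶠ X in 𝓝[Sset n d γbar] X₀, 0 ≤ L (v X) := by
  obtain ⟨k, hk⟩ := ((hv X₀ hX₀).eventually_pos hL).exists
  have hnear : ∀ᶠ X in 𝓝[Sset n d γbar] X₀, ∀ i, 0 < L (Atilde A γbar X k i) := by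
    refine eventually_all.2 fun i => ?_
    have hrow : ContinuousOn (fun X => Atilde A γbar X k i) (Sset n d γbar) :=
      continuousOn_pi.1 (hA.continuousOn_Atilde k) i
    exact (L.continuous_of_finiteDimensional.comp_continuousOn hrow X₀ hX₀).eventually_const_lt
      (hk i)
  filter_upwards [hnear, self_mem_nhdsWithin] with X hXpos hX
  exact (hv X hX).nonneg_of_nonneg hA hX ⟨0, hn⟩ L fun i => (hXpos i).le

/-- Two unit vectors whose coordinate ratios agree up to a factor `c` agree coordinatewise up to
the factor `c`. -/
lemma le_mul_of_euclNorm_eq_one {n : ℕ} {c : ℝ} (hc : 0 ≤ c) {u w : Fin n → ℝ}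
    (hu : euclNorm u = 1) (hw : euclNorm w = 1) (hu0 : ∀ i, 0 ≤ u i) (hw0 : ∀ i, 0 ≤ w i)
    {i : Fin n} (h : ∀ j, w j * u i ≤ c * w i * u j) : u i ≤ c * w i := by
  refine le_of_sq_le_sq ?_ (mul_nonneg hc (hw0 i))
  calc u i ^ 2 = ∑ j, (w j * u i) ^ 2 := by
        simp only [mul_pow, ← Finset.sum_mul, sum_sq_eq_one hw, one_mul]
    _ ≤ ∑ j, (c * w i * u j) ^ 2 := Finset.sum_le_sum fun j _ =>
        pow_le_pow_left₀ (mul_nonneg (hw0 j) (hu0 i)) (h j) 2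
    _ = (c * w i) ^ 2 := by
        simp only [mul_pow, ← Finset.mul_sum, sum_sq_eq_one hu, mul_one]

lemma le_one_of_euclNorm_eq_one {n : ℕ} {u : Fin n → ℝ} (hu : euclNorm u = 1) (i : Fin n) :
    u i ≤ 1 := by
  have h := Finset.single_le_sum (f := fun j => u j ^ 2) (fun j _ => sq_nonneg _)
    (Finset.mem_univ i)
  rw [sum_sq_eq_one hu] at h
  nlinarith

theorem stmt10 {n d : ℕ} (hn : 1 ≤ n) (hd : 1 ≤ d)
    (A : Matrix (Fin n) (Fin n) ℝ) (γbar : Fin n → (Fin d → ℝ) → ℝ)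
    (hA : Assumption2 A γbar)
    (v : Matrix (Fin n) (Fin d) ℝ → Fin n → ℝ)
    (hv : ∀ X₀ ∈ Sset n d γbar, IsLimitVec A γbar X₀ (v X₀)) :
    ContinuousOn v (Sset n d γbar) := by
  intro X₀ hX₀
  obtain ⟨hw1, hw0, -⟩ := hv X₀ hX₀
  refine tendsto_pi_nhds.2 fun i => Metric.tendsto_nhds.2 fun ε hε => ?_
  have hcone : ∀ᶠ X in 𝓝[Sset n d γbar] X₀, ∀ p q,
      v X₀ q * v X p ≤ (1 + ε / 2) * v X₀ p * v X q := by
    refine eventually_all.2 fun p => eventually_all.2 fun q => ?_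
    have h := IsLimitVec.eventually_nonneg hn hA hv hX₀
      (L := ((1 + ε / 2) * v X₀ p) • LinearMap.proj q - v X₀ q • LinearMap.proj p) (by
        have := mul_pos (mul_pos hε (hw0 p)) (hw0 q)
        simp only [LinearMap.sub_apply, LinearMap.smul_apply, LinearMap.proj_apply, smul_eq_mul]
        linarith)
    filter_upwards [h] with X hX
    simpa using hX
  filter_upwards [hcone, self_mem_nhdsWithin] with X hX hXS
  obtain ⟨hu1, hu0, -⟩ := hv X hXS
  have hc : 0 ≤ 1 + ε / 2 := by positivity
  have h1 := le_mul_of_euclNorm_eq_one hc hu1 hw1 (fun j => (hu0 j).le) (fun j => (hw0 j).le)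
    fun j => hX i j
  have h2 := le_mul_of_euclNorm_eq_one hc hw1 hu1 (fun j => (hw0 j).le) (fun j => (hu0 j).le)
    (i := i) fun j => by linarith [hX j i]
  have h3 := le_one_of_euclNorm_eq_one hu1 i
  have h4 := le_one_of_euclNorm_eq_one hw1 i
  rw [Real.dist_eq, abs_lt]
  constructor <;> nlinarith
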